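/- Suppose 𝔤 is the complex simple Lie algebra of type G₂ with simple roots α₁ (short) and α₂ (long). Then for any nonzero root vectors, ad(e_{α₁} + e_{2α₁+α₂})⁴ ≠ 0 and ad(e_{α₁+α₂} + e_{2α₁+α₂})⁴ ≠ 0 in End(𝔤); in particular the nilpotent elements e_{α₁} + e_{2α₁+α₂} and e_{α₁+α₂} + e_{2α₁+α₂} have height at least 4. -/

import Mathlib

/- Background setup: a finite reduced crystallographic root system `Φ` with chosen
positive roots `Φ⁺` in a euclidean space `V`, the Cartan pairing, and the basic
combinatorial notions used in the statement. -/

open scoped RealInnerProductSpace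

noncomputable section

variable {V : Type*} [NormedAddCommGroup V] [InnerProductSpace ℝ V]

/-- The Cartan pairing `⟨α, β⟩ = 2 (α, β) / (β, β)`. -/
def cpair (α β : V) : ℝ := 2 * ⟪α, β⟫ / ⟪β, β⟫

/-- The reflection associated to `β`, as a linear endomorphism of `V`:
`v ↦ v - (2 (β, v)/(β, β)) • β`. -/
def reflEnd (β : V) : Module.End ℝ V :=
  LinearMap.id -
    (LinearMap.toSpanSingleton ℝ V β ∘ₗ ((2 / ⟪β, β⟫) • (innerSL ℝ β).toLinearMap))

/-- A subset of `V` is orthogonal if the Cartan pairing of any two distinct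
elements vanishes. -/
def OrthogonalSet (S : Set V) : Prop := ∀ γ ∈ S, ∀ γ' ∈ S, γ ≠ γ' → cpair γ γ' = 0

/-- A finite reduced crystallographic root system in the euclidean space `V`,
together with a choice of positive roots. -/
structure RootSystemData (V : Type*) [NormedAddCommGroup V] [InnerProductSpace ℝ V] where
  /-- the set of roots Φ -/
  roots : Set V
  /-- the set of positive roots Φ⁺ -/
  pos : Set V
  finite : roots.Finite
  ne_zero : ∀ α ∈ roots, α ≠ 0
  span_eq_top : Submodule.span ℝ roots = ⊤
  reduced : ∀ α ∈ roots, ∀ t : ℝ, t • α ∈ roots → t = 1 ∨ t = -1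
  crystallographic : ∀ α ∈ roots, ∀ β ∈ roots, ∃ n : ℤ, cpair α β = (n : ℝ)
  reflect_mem : ∀ α ∈ roots, ∀ β ∈ roots, reflEnd β α ∈ roots
  pos_subset : pos ⊆ roots
  pos_iff : ∀ α ∈ roots, (α ∈ pos ↔ ¬ (-α ∈ pos))
  pos_add : ∀ α ∈ pos, ∀ β ∈ pos, α + β ∈ roots → α + β ∈ pos

namespace RootSystemData

variable (D : RootSystemData V)

/-- Irreducibility: the roots admit no nontrivial partition into two mutually
orthogonal parts. -/
def IsIrreducible : Prop :=
  D.roots.Nonempty ∧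
    ∀ s ⊆ D.roots, (∀ α ∈ s, ∀ β ∈ D.roots \ s, ⟪α, β⟫ = 0) → s = ∅ ∨ s = D.roots

/-- An irreducible root system is not of type `G₂` iff no Cartan pairing of two
roots equals `±3`. -/
def NotG2 : Prop := ∀ α ∈ D.roots, ∀ β ∈ D.roots, cpair α β ≠ 3 ∧ cpair α β ≠ -3

/-- An irreducible root system is of type `G₂` iff some Cartan pairing of two
roots equals `±3`. -/
def IsG2 : Prop :=
  D.IsIrreducible ∧ ∃ α ∈ D.roots, ∃ β ∈ D.roots, cpair α β = 3 ∨ cpair α β = -3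

/-- All roots have the same length (types A, D, E). -/
def SimplyLaced : Prop := ∀ α ∈ D.roots, ∀ β ∈ D.roots, ⟪α, α⟫ = ⟪β, β⟫

/-- There are exactly two root lengths, with squared-length ratio 2
(types B, C, F₄). -/
def DoublyLaced : Prop :=
  (∃ α ∈ D.roots, ∃ β ∈ D.roots, ⟪β, β⟫ = 2 * ⟪α, α⟫) ∧
    ∀ α ∈ D.roots, ∀ β ∈ D.roots,
      ⟪α, α⟫ = ⟪β, β⟫ ∨ ⟪β, β⟫ = 2 * ⟪α, α⟫ ∨ ⟪α, α⟫ = 2 * ⟪β, β⟫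

/-- A root of maximal length. -/
def IsLong (α : V) : Prop := α ∈ D.roots ∧ ∀ β ∈ D.roots, ⟪β, β⟫ ≤ ⟪α, α⟫

/-- A root of minimal length. -/
def IsShort (α : V) : Prop := α ∈ D.roots ∧ ∀ β ∈ D.roots, ⟪α, α⟫ ≤ ⟪β, β⟫

/-- A set of positive roots is convex if any root which is a linear combination of
two of its elements with positive coefficients lies in it. -/
def ConvexSubset (S : Set V) : Prop :=
  ∀ α ∈ S, ∀ β ∈ S, ∀ a b : ℝ, 0 < a → 0 < b →
    a • α + b • β ∈ D.roots → a • α + b • β ∈ S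

/-- A subset `Ψ ⊆ Φ⁺` is biconvex if both `Ψ` and `Φ⁺ \ Ψ` are convex. -/
def Biconvex (S : Set V) : Prop :=
  S ⊆ D.pos ∧ D.ConvexSubset S ∧ D.ConvexSubset (D.pos \ S)

/-- A subset `Ψ ⊆ Φ⁺` is a combinatorial ideal if `α ∈ Ψ`, `β ∈ Φ⁺`, `α + β ∈ Φ⁺`
imply `α + β ∈ Ψ`. -/
def CombIdeal (S : Set V) : Prop :=
  S ⊆ D.pos ∧ ∀ α ∈ S, ∀ β ∈ D.pos, α + β ∈ D.pos → α + β ∈ S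

end RootSystemData

/- The Weyl group: words in the simple reflections, reduced expressions, length,
inversion sets, and the (fully) commutative elements. -/

/-- The product of the reflections attached to a word (a list of roots). -/
def wordProd (l : List V) : Module.End ℝ V := (l.map reflEnd).prod

/-- The alternating word `[α, β, α, β, ...]` of length `n`. -/
def altWord (α β : V) : ℕ → List V
  | 0 => []
  | n + 1 => α :: altWord β α n

namespace RootSystemData

variable (D : RootSystemData V)

/-- The simple roots: the positive roots which are not sums of two positive
roots. -/
def simpleRoots : Set V :=
  {α | α ∈ D.pos ∧ ¬ ∃ β ∈ D.pos, ∃ γ ∈ D.pos, α = β + γ}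

/-- A word in the simple reflections, encoded as a list of simple roots. -/
def IsWord (l : List V) : Prop := ∀ α ∈ l, α ∈ D.simpleRoots

/-- Membership in the Weyl group: `w` is a product of simple reflections. -/
def InWeyl (w : Module.End ℝ V) : Prop := ∃ l : List V, D.IsWord l ∧ wordProd l = w

/-- A reduced word: a word of minimal length among all words with the same
product. -/
def IsReducedWord (l : List V) : Prop :=
  D.IsWord l ∧
    ∀ l' : List V, D.IsWord l' → wordProd l' = wordProd l → l.length ≤ l'.length

/-- The length of a Weyl group element. -/
noncomputable def len (w : Module.End ℝ V) : ℕ :=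
  sInf {n | ∃ l : List V, D.IsWord l ∧ wordProd l = w ∧ l.length = n}

/-- The inversion set `Φ(w) = {α ∈ Φ⁺ | w(α) ∈ Φ⁻}`. -/
def inversions (w : Module.End ℝ V) : Set V :=
  {α | α ∈ D.pos ∧ w α ∈ D.roots ∧ w α ∉ D.pos}

/-- `w` is fully commutative: no reduced expression for `w` contains a contiguous
substring `s_α s_β s_α s_β ⋯` of length `m(s_α, s_β)`, where `s_α, s_β` are
non-commuting simple reflections and `m(s_α, s_β)` is the order of `s_α s_β`. -/
def FullyCommutative (w : Module.End ℝ V) : Prop :=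
  D.InWeyl w ∧
    ∀ l : List V, D.IsReducedWord l → wordProd l = w →
      ∀ α ∈ D.simpleRoots, ∀ β ∈ D.simpleRoots,
        ¬ Commute (reflEnd α) (reflEnd β) →
          ¬ (altWord α β (orderOf (reflEnd α * reflEnd β)) <:+: l)

/-- `w` is commutative: no reduced expression for `w` contains a substring
`s_α s_β s_α` with `α, β` simple and `‖α‖ ≤ ‖β‖`. -/
def Commutative (w : Module.End ℝ V) : Prop :=
  D.InWeyl w ∧
    ∀ l : List V, D.IsReducedWord l → wordProd l = w →
      ∀ α ∈ D.simpleRoots, ∀ β ∈ D.simpleRoots, ‖α‖ ≤ ‖β‖ →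
        ¬ ([α, β, α] <:+: l)

end RootSystemData

/- The Lie-theoretic setup: a finite-dimensional complex simple Lie algebra `𝔤`
with Cartan subalgebra `𝔱`, whose root space decomposition is indexed by the
root system `Φ ⊆ V`. -/

/-- A finite-dimensional simple complex Lie algebra `L`, together with a Cartan
subalgebra and its root space decomposition, whose root system is `Φ ⊆ V` with a
choice of positive roots (determining the Borel subalgebra `𝔟 = 𝔱 ⊕ 𝔫`). -/
structure LieRootData (V : Type*) [NormedAddCommGroup V] [InnerProductSpace ℝ V]
    (L : Type*) [LieRing L] [LieAlgebra ℂ L] extends RootSystemData V where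
  /-- the Cartan subalgebra 𝔱 -/
  cartan : LieSubalgebra ℂ L
  /-- the root space 𝔤_α attached to each root α -/
  rs : V → Submodule ℂ L
  finiteDim : FiniteDimensional ℂ L
  isSimple : LieAlgebra.IsSimple ℂ L
  isCartan : cartan.IsCartanSubalgebra
  rs_dim : ∀ α ∈ roots, Module.finrank ℂ (rs α) = 1
  sup_eq_top : cartan.toSubmodule ⊔ (⨆ α ∈ roots, rs α) = ⊤
  indep : ∀ α ∈ roots, rs α ⊓ (cartan.toSubmodule ⊔ ⨆ β ∈ roots \ {α}, rs β) = ⊥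
  weight_vec : ∀ α ∈ roots, ∀ h ∈ cartan, ∀ x ∈ rs α, ∃ c : ℂ, ⁅h, x⁆ = c • x
  bracket_mem : ∀ α ∈ roots, ∀ β ∈ roots, α + β ∈ roots →
    ∀ x ∈ rs α, ∀ y ∈ rs β, ⁅x, y⁆ ∈ rs (α + β)
  bracket_ne_zero : ∀ α ∈ roots, ∀ β ∈ roots, α + β ∈ roots →
    ∀ x ∈ rs α, x ≠ 0 → ∀ y ∈ rs β, y ≠ 0 → ⁅x, y⁆ ≠ 0
  bracket_eq_zero : ∀ α ∈ roots, ∀ β ∈ roots, α + β ∉ roots → α + β ≠ 0 →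
    ∀ x ∈ rs α, ∀ y ∈ rs β, ⁅x, y⁆ = 0
  bracket_cartan_mem : ∀ α ∈ roots, ∀ x ∈ rs α, ∀ y ∈ rs (-α), ⁅x, y⁆ ∈ cartan

namespace LieRootData

variable {L : Type*} [LieRing L] [LieAlgebra ℂ L] (D : LieRootData V L)

/-- The nilradical `𝔫 = ⊕_{α ∈ Φ⁺} 𝔤_α` of the Borel subalgebra, as a submodule. -/
def nilrad : Submodule ℂ L := ⨆ α ∈ D.pos, D.rs α

/-- The Borel subalgebra `𝔟 = 𝔱 ⊕ 𝔫`, as a submodule. -/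
def borel : Submodule ℂ L := D.cartan.toSubmodule ⊔ D.nilrad

/-- The subspace `𝔞_Ψ = ⊕_{α ∈ Ψ} 𝔤_α` attached to a subset `Ψ ⊆ Φ⁺`. -/
def aSubspace (S : Set V) : Submodule ℂ L := ⨆ α ∈ S, D.rs α

end LieRootData

/-- A subspace of `𝔫` is spherical if `ad(x)^4 = 0` for every `x` in it. -/
def IsSphericalSubspace {L : Type*} [LieRing L] [LieAlgebra ℂ L]
    (a : Submodule ℂ L) : Prop :=
  ∀ x ∈ a, (LieAlgebra.ad ℂ L x) ^ 4 = 0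

/-- The height of a nilpotent element `x`: `max {n | ad(x)^n ≠ 0}`. -/
noncomputable def heightOf {L : Type*} [LieRing L] [LieAlgebra ℂ L] (x : L) : ℕ :=
  sSup {n : ℕ | (LieAlgebra.ad ℂ L x) ^ n ≠ 0}

/-! ### Root system part -/

/-- Two short roots at angle 60 degrees whose sum is a (long) root. -/
structure Cfg (D : RootSystemData V) (p q : V) (n : ℝ) : Prop where
  hn : 0 < n
  hp : p ∈ D.roots
  hq : q ∈ D.roots
  hpq : p + q ∈ D.roots
  pp : ⟪p, p⟫ = n
  qq : ⟪q, q⟫ = n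
  pq : ⟪p, q⟫ = n / 2

lemma reflEnd_apply' (β α : V) : reflEnd β α = α - (2 * ⟪β, α⟫ / ⟪β, β⟫) • β := by
  have : reflEnd β α = α - (2 / ⟪β, β⟫ * ⟪β, α⟫) • β := rfl
  rw [this]
  congr 2
  ring

lemma RootSystemData.neg_mem (D : RootSystemData V) {α : V} (h : α ∈ D.roots) :
    -α ∈ D.roots := by
  have h1 := D.reflect_mem α h α h
  rw [reflEnd_apply'] at h1
  have h0 : ⟪α, α⟫ ≠ 0 := by simpa using D.ne_zero α h
  rw [mul_div_assoc, div_self h0] at h1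
  convert h1 using 1
  module

namespace Cfg

variable {D : RootSystemData V} {p q : V} {n : ℝ}

lemma qp (C : Cfg D p q n) : ⟪q, p⟫ = n / 2 := by rw [real_inner_comm, C.pq]

lemma sub_mem (C : Cfg D p q n) : q - p ∈ D.roots := by
  have h1 := D.reflect_mem q C.hq p C.hp
  rw [reflEnd_apply', C.pq, C.pp] at h1
  have hn := C.hn.ne'
  have : 2 * (n / 2) / n = 1 := by field_simp
  rw [this] at h1
  simpa using h1

lemma sub_two_mem (C : Cfg D p q n) : q - (2 : ℝ) • p ∈ D.roots := by
  have h1 := D.reflect_mem _ C.hpq p C.hp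
  rw [reflEnd_apply', inner_add_right, C.pq, C.pp] at h1
  have hn := C.hn.ne'
  have : 2 * (n + n / 2) / n = 3 := by field_simp; norm_num
  rw [this] at h1
  convert h1 using 1
  module

lemma symm (C : Cfg D p q n) : Cfg D q p n where
  hn := C.hn
  hp := C.hq
  hq := C.hp
  hpq := by rw [add_comm]; exact C.hpq
  pp := C.qq
  qq := C.pp
  pq := C.qp

/-- rotation by 60 degrees -/
lemma rot (C : Cfg D p q n) : Cfg D q (q - p) n where
  hn := C.hn
  hp := C.hq
  hq := C.sub_mem
  hpq := by
    have := D.neg_mem C.symm.sub_two_mem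
    convert this using 1
    module
  pp := C.qq
  qq := by simp only [inner_sub_left, inner_sub_right, C.qq, C.pp, C.pq, C.qp]; ring
  pq := by simp only [inner_sub_right, C.qq, C.qp]; ring

lemma int_aux1 (x y c1 c2 : ℤ) (h0 : 0 < x ^ 2 + x * y + y ^ 2)
    (h1 : c1 * (x ^ 2 + x * y + y ^ 2) = 2 * x + y)
    (h2 : c2 * (x ^ 2 + x * y + y ^ 2) = x + 2 * y) :
    x ^ 2 + x * y + y ^ 2 = 1 ∨ x ^ 2 + x * y + y ^ 2 = 3 := by
  have hx : x ^ 2 + x * y + y ^ 2 ∣ 3 * x := ⟨2 * c1 - c2, by linarith⟩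
  have hy : x ^ 2 + x * y + y ^ 2 ∣ 3 * y := ⟨2 * c2 - c1, by linarith⟩
  have key : ∀ x y : ℤ, x ^ 2 + x * y + y ^ 2 ∣ 3 * y → -4 ≤ y ∧ y ≤ 4 := by
    intro x y hy
    rcases eq_or_ne y 0 with rfl | hy0
    · simp
    have := Int.le_of_dvd (by positivity) ((dvd_abs _ _).2 hy)
    rw [abs_mul, abs_of_nonneg (by norm_num : (0:ℤ) ≤ 3)] at this
    have h4 : |y| ≤ 4 := by
      have hpos : 0 < |y| := by positivity
      nlinarith [sq_nonneg (2 * x + y), sq_abs y]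
    exact abs_le.1 h4
  obtain ⟨hy1, hy2⟩ := key x y hy
  obtain ⟨hx1, hx2⟩ := key y x (by convert hx using 1; ring)
  interval_cases x <;> interval_cases y <;> omega

lemma int_aux2 (x y : ℤ)
    (h1 : 2 * x + y = 0 ∨ x ^ 2 + x * y + y ^ 2 < |2 * x + y|)
    (h2 : x + 2 * y = 0 ∨ x ^ 2 + x * y + y ^ 2 < |x + 2 * y|)
    (h3 : x - y = 0 ∨ x ^ 2 + x * y + y ^ 2 < |x - y|) : x = 0 ∧ y = 0 := by
  have b : ∀ s t N : ℤ, 4 * N = s ^ 2 + 3 * t ^ 2 → (s = 0 ∨ N < |s|) → -3 ≤ s ∧ s ≤ 3 := by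
    intro s t N hN h
    rcases h with rfl | h
    · simp
    · apply abs_le.1
      have : |s| < 4 := by
        nlinarith [sq_abs s, sq_nonneg t, abs_nonneg s]
      omega
  obtain ⟨a1, a2⟩ := b _ y _ (by ring) h1
  obtain ⟨b1, b2⟩ := b _ x _ (by ring) h2
  have x1 : -3 ≤ x := by omega
  have x2 : x ≤ 3 := by omega
  have y1 : -3 ≤ y := by omega
  have y2 : y ≤ 3 := by omega
  interval_cases x <;> interval_cases y <;> simp_all

lemma lin_or_orth (C : Cfg D p q n) {γ : V} (hγ : γ ∈ D.roots) :
    (∃ x y : ℤ, γ = (x : ℝ) • p + (y : ℝ) • q ∧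
      (x ^ 2 + x * y + y ^ 2 = 1 ∨ x ^ 2 + x * y + y ^ 2 = 3)) ∨
      (⟪γ, p⟫ = 0 ∧ ⟪γ, q⟫ = 0) := by
  have hn := C.hn
  have hm : 0 < ⟪γ, γ⟫ := by
    have := D.ne_zero γ hγ
    exact real_inner_self_pos.2 this
  obtain ⟨g1, hg1⟩ := D.crystallographic γ hγ p C.hp
  obtain ⟨g2, hg2⟩ := D.crystallographic γ hγ q C.hq
  obtain ⟨k, hk⟩ := D.crystallographic γ hγ _ C.hpq
  obtain ⟨c1, hc1⟩ := D.crystallographic p C.hp γ hγ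
  obtain ⟨c2, hc2⟩ := D.crystallographic q C.hq γ hγ
  simp only [cpair] at hg1 hg2 hk hc1 hc2
  rw [C.pp, div_eq_iff hn.ne'] at hg1
  rw [C.qq, div_eq_iff hn.ne'] at hg2
  rw [div_eq_iff hm.ne', real_inner_comm] at hc1 hc2
  have h3 : ⟪p + q, p + q⟫ = 3 * n := by
    simp only [inner_add_left, inner_add_right, C.pp, C.qq, C.pq, C.qp]; ring
  rw [h3, div_eq_iff (by positivity), inner_add_right] at hk
  have hkk : g1 + g2 = 3 * k := by
    have : ((g1 : ℝ) + g2 - 3 * k) * n = 0 := by linarith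
    have := (mul_eq_zero.1 this).resolve_right hn.ne'
    have : ((g1 + g2 : ℤ) : ℝ) = ((3 * k : ℤ) : ℝ) := by push_cast; linarith
    exact_mod_cast this
  obtain ⟨x, hx⟩ : ∃ x, x = g1 - k := ⟨_, rfl⟩
  obtain ⟨y, hy⟩ : ∃ y, y = g2 - k := ⟨_, rfl⟩
  have e1 : g1 = 2 * x + y := by omega
  have e2 : g2 = x + 2 * y := by omega
  clear hx hy hk hkk
  subst e1 e2
  push_cast at hg1 hg2
  set d := γ - ((x : ℝ) • p + (y : ℝ) • q) with hd
  have hdd : ⟪γ, γ⟫ = ⟪d, d⟫ + n * (x ^ 2 + x * y + y ^ 2) := by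
    rw [hd]
    simp only [inner_sub_left, inner_sub_right, inner_add_left, inner_add_right,
      real_inner_smul_left, real_inner_smul_right, C.pp, C.qq, C.pq, C.qp,
      real_inner_comm γ p, real_inner_comm γ q]
    have e1 : ⟪γ, p⟫ = (2 * x + y) * n / 2 := by linarith
    have e2 : ⟪γ, q⟫ = (x + 2 * y) * n / 2 := by linarith
    have e3 : ⟪p, γ⟫ = (2 * x + y) * n / 2 := by rw [real_inner_comm]; linarith
    have e4 : ⟪q, γ⟫ = (x + 2 * y) * n / 2 := by rw [real_inner_comm]; linarith
    try rw [e1]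
    try rw [e2]
    try rw [e3]
    try rw [e4]
    ring
  rcases eq_or_ne d 0 with h0 | h0
  · left
    refine ⟨x, y, sub_eq_zero.1 h0, ?_⟩
    rw [h0, inner_zero_left, zero_add] at hdd
    rw [hdd] at hm hc1 hc2
    have hN : (0 : ℝ) < x ^ 2 + x * y + y ^ 2 := pos_of_mul_pos_right hm hn.le
    refine int_aux1 x y c1 c2 (by exact_mod_cast hN) ?_ ?_
    · have : n * ((c1 : ℝ) * (x ^ 2 + x * y + y ^ 2)) = n * (2 * x + y) := by linarith
      have := mul_left_cancel₀ hn.ne' this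
      exact_mod_cast this
    · have : n * ((c2 : ℝ) * (x ^ 2 + x * y + y ^ 2)) = n * (x + 2 * y) := by linarith
      have := mul_left_cancel₀ hn.ne' this
      exact_mod_cast this
  · right
    have hdpos : 0 < ⟪d, d⟫ := real_inner_self_pos.2 h0
    have aux : ∀ c s : ℤ, (c : ℝ) * ⟪γ, γ⟫ = s * n →
        s = 0 ∨ x ^ 2 + x * y + y ^ 2 < |s| := by
      intro c s hcs
      rcases eq_or_ne s 0 with hs | hs
      · exact Or.inl hs
      right
      have hc : c ≠ 0 := by
        rintro rfl
        simp only [Int.cast_zero, zero_mul] at hcs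
        have := (mul_eq_zero.1 hcs.symm).resolve_right hn.ne'
        exact hs (by exact_mod_cast this)
      have hc1 : (1 : ℝ) ≤ |(c : ℝ)| := by
        have := Int.one_le_abs hc
        exact_mod_cast this
      have h2 : |(c : ℝ)| * ⟪γ, γ⟫ = |(s : ℝ)| * n := by
        have := congrArg abs hcs
        rwa [abs_mul, abs_mul, abs_of_pos hm, abs_of_pos hn] at this
      have h3 : n * ((x : ℝ) ^ 2 + x * y + y ^ 2) < n * |(s : ℝ)| := by nlinarith
      have := lt_of_mul_lt_mul_left h3 hn.le
      exact_mod_cast this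
    obtain ⟨rfl, rfl⟩ := int_aux2 x y (aux c1 _ (by push_cast; linarith))
      (aux c2 _ (by push_cast; linarith)) (aux (c1 - c2) _ (by push_cast; linarith))
    simp at hg1 hg2
    exact ⟨hg1, hg2⟩

lemma lin (C : Cfg D p q n) (hI : D.IsIrreducible) {γ : V} (hγ : γ ∈ D.roots) :
    ∃ x y : ℤ, γ = (x : ℝ) • p + (y : ℝ) • q ∧
      (x ^ 2 + x * y + y ^ 2 = 1 ∨ x ^ 2 + x * y + y ^ 2 = 3) := by
  let s : Set V := {γ | γ ∈ D.roots ∧ ∃ x y : ℤ, γ = (x : ℝ) • p + (y : ℝ) • q ∧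
      (x ^ 2 + x * y + y ^ 2 = 1 ∨ x ^ 2 + x * y + y ^ 2 = 3)}
  have hs : s = ∅ ∨ s = D.roots := by
    refine hI.2 s (fun _ h => h.1) ?_
    rintro α ⟨hα, x, y, rfl, -⟩ β ⟨hβ, hβs⟩
    rcases C.lin_or_orth hβ with h | ⟨h1, h2⟩
    · exact absurd ⟨hβ, h⟩ hβs
    · rw [real_inner_comm, inner_add_right, real_inner_smul_right, real_inner_smul_right, h1, h2]
      simp
  have hps : p ∈ s := ⟨C.hp, 1, 0, by simp, by simp⟩
  rcases hs with h | h
  · rw [h] at hps; exact hps.elim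
  · rw [← h] at hγ; exact hγ.2

lemma norm_cases (C : Cfg D p q n) (hI : D.IsIrreducible) {γ : V} (hγ : γ ∈ D.roots) :
    ⟪γ, γ⟫ = n ∨ ⟪γ, γ⟫ = 3 * n := by
  obtain ⟨x, y, rfl, h⟩ := C.lin hI hγ
  have : ⟪(x : ℝ) • p + (y : ℝ) • q, (x : ℝ) • p + (y : ℝ) • q⟫ =
      ((x ^ 2 + x * y + y ^ 2 : ℤ) : ℝ) * n := by
    simp only [inner_add_left, inner_add_right,
      real_inner_smul_left, real_inner_smul_right, C.pp, C.qq, C.pq, C.qp]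
    push_cast; ring
  rw [this]
  rcases h with h | h <;> rw [h] <;> simp

lemma not_mem (C : Cfg D p q n) (hI : D.IsIrreducible) {γ : V} (x y : ℝ)
    (hγ : γ = x • p + y • q)
    (h1 : x ^ 2 + x * y + y ^ 2 ≠ 1) (h3 : x ^ 2 + x * y + y ^ 2 ≠ 3) : γ ∉ D.roots := by
  intro h
  have h2 := C.norm_cases hI h
  have : ⟪x • p + y • q, x • p + y • q⟫ = (x ^ 2 + x * y + y ^ 2) * n := by
    simp only [inner_add_left, inner_add_right,
      real_inner_smul_left, real_inner_smul_right, C.pp, C.qq, C.pq, C.qp]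
    ring
  rw [hγ, this] at h2
  rcases h2 with h2 | h2
  · exact h1 (mul_right_cancel₀ C.hn.ne' (by linarith))
  · exact h3 (mul_right_cancel₀ C.hn.ne' h2)

lemma ne_zero' (C : Cfg D p q n) {γ : V} (x y : ℝ)
    (hγ : γ = x • p + y • q) (h1 : x ^ 2 + x * y + y ^ 2 ≠ 0) : γ ≠ 0 := by
  rintro rfl
  have : ⟪x • p + y • q, x • p + y • q⟫ = (x ^ 2 + x * y + y ^ 2) * n := by
    simp only [inner_add_left, inner_add_right,
      real_inner_smul_left, real_inner_smul_right, C.pp, C.qq, C.pq, C.qp]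
    ring
  rw [← hγ, inner_zero_left] at this
  exact h1 ((mul_eq_zero.1 this.symm).resolve_right C.hn.ne')

end Cfg

lemma exists_cfg (D : RootSystemData V) (h : D.IsG2) : ∃ p q n, Cfg D p q n := by
  obtain ⟨-, α', hα', β, hβ, h⟩ := h
  obtain ⟨α, hα, h⟩ : ∃ α ∈ D.roots, cpair α β = 3 := by
    rcases h with h | h
    · exact ⟨α', hα', h⟩
    · refine ⟨-α', D.neg_mem hα', ?_⟩
      simp only [cpair, inner_neg_left] at h ⊢
      linear_combination -h
  have hn : 0 < ⟪β, β⟫ := real_inner_self_pos.2 (D.ne_zero β hβ)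
  have hm : 0 < ⟪α, α⟫ := real_inner_self_pos.2 (D.ne_zero α hα)
  obtain ⟨k, hk⟩ := D.crystallographic β hβ α hα
  have hαβ : ⟪α, β⟫ = 3 * ⟪β, β⟫ / 2 := by
    rw [cpair, div_eq_iff hn.ne'] at h; linarith
  have hβα : ⟪β, α⟫ = 3 * ⟪β, β⟫ / 2 := by rw [real_inner_comm, hαβ]
  have hk' := hk
  rw [cpair, hβα, div_eq_iff hm.ne'] at hk'
  have cs : ⟪α, β⟫ * ⟪α, β⟫ ≤ ⟪α, α⟫ * ⟪β, β⟫ := real_inner_mul_inner_self_le α β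
  rw [hαβ] at cs
  have cs' : 9 / 4 * ⟪β, β⟫ ≤ ⟪α, α⟫ := by
    by_contra hc
    push Not at hc
    nlinarith
  have k1 : k = 1 := by
    have hk0 : (0 : ℝ) < k := by
      by_contra hc
      push Not at hc
      nlinarith
    have hk2 : (k : ℝ) < 2 := by
      by_contra hc
      push Not at hc
      nlinarith
    have a : (0 : ℤ) < k := by exact_mod_cast hk0
    have b : k < (2 : ℤ) := by exact_mod_cast hk2
    omega
  subst k1
  have haa : ⟪α, α⟫ = 3 * ⟪β, β⟫ := by push_cast at hk'; linarith
  refine ⟨β, α - β, ⟪β, β⟫, hn, hβ, ?_, by simpa using hα, rfl, ?_, ?_⟩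
  · have h1 := D.reflect_mem β hβ α hα
    rw [reflEnd_apply', haa, hαβ] at h1
    have : 2 * (3 * ⟪β, β⟫ / 2) / (3 * ⟪β, β⟫) = 1 := by field_simp
    rw [this] at h1
    simpa using D.neg_mem h1
  · simp only [inner_sub_left, inner_sub_right, haa, hαβ, hβα]; ring
  · simp only [inner_sub_right, hβα]; ring

/-- two simple roots are not the two elements of a pair `r, r + r'` with sum relations -/
lemma simple_sub (D : RootSystemData V) {a b : V} (ha : a ∈ D.simpleRoots)
    (hb : b ∈ D.simpleRoots) : b - a ∉ D.roots := by
  intro h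
  by_cases hp : b - a ∈ D.pos
  · exact hb.2 ⟨b - a, hp, a, ha.1, by abel⟩
  · have h' := D.neg_mem h
    have hp' : -(b - a) ∈ D.pos := by
      by_contra hc
      exact hp ((D.pos_iff _ h).2 hc)
    exact ha.2 ⟨-(b - a), hp', b, hb.1, by abel⟩

lemma simple_orth (D : RootSystemData V) {a b r s : V} (ha : a ∈ D.simpleRoots)
    (hb : b ∈ D.simpleRoots) (hr : r ∈ D.roots) (hs : s ∈ D.roots)
    (h1 : b = r + s) (h2 : a = r - s) : False := by
  have pn : ∀ x ∈ D.roots, x ∈ D.pos ∨ -x ∈ D.pos := by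
    intro x hx
    by_cases h : x ∈ D.pos
    · exact Or.inl h
    · right
      by_contra hc
      exact h ((D.pos_iff _ hx).2 hc)
  have ha' := D.pos_subset ha.1
  have hb' := D.pos_subset hb.1
  rcases pn r hr with hr' | hr' <;> rcases pn s hs with hs' | hs'
  · exact hb.2 ⟨r, hr', s, hs', h1⟩
  · exact ha.2 ⟨r, hr', -s, hs', by rw [h2]; abel⟩
  · have : -a = -r + s := by rw [h2]; abel
    have h := D.pos_add _ hr' _ hs' (by rw [← this]; exact D.neg_mem ha')
    rw [← this] at h
    exact (D.pos_iff _ ha').1 ha.1 h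
  · have : -b = -r + -s := by rw [h1]; abel
    have h := D.pos_add _ hr' _ hs' (by rw [← this]; exact D.neg_mem hb')
    rw [← this] at h
    exact (D.pos_iff _ hb').1 hb.1 h

lemma int_bound (x y : ℤ) (h : x ^ 2 + x * y + y ^ 2 = 1 ∨ x ^ 2 + x * y + y ^ 2 = 3) :
    -2 ≤ x ∧ x ≤ 2 ∧ -2 ≤ y ∧ y ≤ 2 := by
  refine ⟨?_, ?_, ?_, ?_⟩ <;> rcases h with h | h <;>
    nlinarith [sq_nonneg (2 * x + y), sq_nonneg (x + 2 * y)]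

lemma simple_cfg (D : RootSystemData V) (h : D.IsG2) {α₁ α₂ : V}
    (h1 : α₁ ∈ D.simpleRoots) (h2 : α₂ ∈ D.simpleRoots) (hlt : ‖α₁‖ < ‖α₂‖) :
    ∃ q n, Cfg D α₁ q n ∧ α₂ = q - (2 : ℝ) • α₁ := by
  obtain ⟨p, q, n, C⟩ := exists_cfg D h
  have hI := h.1
  have m1 := D.pos_subset h1.1
  have m2 := D.pos_subset h2.1
  have hlt' : ⟪α₁, α₁⟫ < ⟪α₂, α₂⟫ := by
    rw [real_inner_self_eq_norm_sq, real_inner_self_eq_norm_sq]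
    gcongr
  have hn := C.hn
  obtain ⟨ha1, ha2⟩ : ⟪α₁, α₁⟫ = n ∧ ⟪α₂, α₂⟫ = 3 * n := by
    rcases C.norm_cases hI m1 with h1 | h1 <;> rcases C.norm_cases hI m2 with h2 | h2 <;>
      first | exact ⟨h1, h2⟩ | (exfalso; linarith)
  obtain ⟨q', C'⟩ : ∃ q', Cfg D α₁ q' n := by
    obtain ⟨x, y, rfl, hxy⟩ := C.lin hI m1
    have e : ⟪(x : ℝ) • p + (y : ℝ) • q, (x : ℝ) • p + (y : ℝ) • q⟫ =
        ((x ^ 2 + x * y + y ^ 2 : ℤ) : ℝ) * n := by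
      simp only [inner_add_left, inner_add_right,
        real_inner_smul_left, real_inner_smul_right, C.pp, C.qq, C.pq, C.qp]
      push_cast; ring
    have hxy1 : x ^ 2 + x * y + y ^ 2 = 1 := by
      rcases hxy with h | h
      · exact h
      · rw [h] at e; push_cast at e; linarith
    clear e ha1 m1 h1 hlt hlt'
    obtain ⟨b1, b2, b3, b4⟩ := int_bound x y hxy
    have R1 := C.rot
    have R2 := R1.rot
    have R3 := R2.rot
    have R4 := R3.rot
    have R5 := R4.rot
    have : (x = 1 ∧ y = 0) ∨ (x = 0 ∧ y = 1) ∨ (x = -1 ∧ y = 1) ∨ (x = -1 ∧ y = 0) ∨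
        (x = 0 ∧ y = -1) ∨ (x = 1 ∧ y = -1) := by
      interval_cases x <;> interval_cases y <;> simp_all
    rcases this with ⟨rfl, rfl⟩ | ⟨rfl, rfl⟩ | ⟨rfl, rfl⟩ | ⟨rfl, rfl⟩ | ⟨rfl, rfl⟩ | ⟨rfl, rfl⟩
    · exact ⟨_, by convert C using 1; module⟩
    · exact ⟨_, by convert R1 using 1; module⟩
    · exact ⟨_, by convert R2 using 1; module⟩
    · exact ⟨_, by convert R3 using 1; module⟩
    · exact ⟨_, by convert R4 using 1; module⟩
    · exact ⟨_, by convert R5 using 1; module⟩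
  clear C
  obtain ⟨x, y, hα, hxy⟩ := C'.lin hI m2
  have e : ⟪(x : ℝ) • α₁ + (y : ℝ) • q', (x : ℝ) • α₁ + (y : ℝ) • q'⟫ =
      ((x ^ 2 + x * y + y ^ 2 : ℤ) : ℝ) * n := by
    simp only [inner_add_left, inner_add_right,
      real_inner_smul_left, real_inner_smul_right, C'.pp, C'.qq, C'.pq, C'.qp]
    push_cast; ring
  have hxy1 : x ^ 2 + x * y + y ^ 2 = 3 := by
    rcases hxy with h | h
    · rw [← hα, h] at e; push_cast at e; linarith
    · exact h
  obtain ⟨b1, b2, b3, b4⟩ := int_bound x y hxy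
  have : (x = 1 ∧ y = 1) ∨ (x = -1 ∧ y = -1) ∨ (x = -2 ∧ y = 1) ∨ (x = 2 ∧ y = -1) ∨
      (x = -1 ∧ y = 2) ∨ (x = 1 ∧ y = -2) := by
    clear e hα hxy
    interval_cases x <;> interval_cases y <;> simp_all
  have hs := simple_sub D h1 h2
  have Cs := C'.sub_mem
  rcases this with ⟨rfl, rfl⟩ | ⟨rfl, rfl⟩ | ⟨rfl, rfl⟩ | ⟨rfl, rfl⟩ | ⟨rfl, rfl⟩ | ⟨rfl, rfl⟩
  · exact absurd (by rw [hα]; convert C'.hq using 1; module) hs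
  · exact ⟨α₁ - q', n, C'.symm.rot, by rw [hα]; module⟩
  · exact ⟨q', n, C', by rw [hα]; module⟩
  · exact absurd (by rw [hα]; convert D.neg_mem Cs using 1; module) hs
  · exact (simple_orth D h1 h2 C'.hq Cs (by rw [hα]; module) (by module)).elim
  · exact (simple_orth D h1 h2 (D.neg_mem Cs) (D.neg_mem C'.hq) (by rw [hα]; module)
      (by module)).elim

/-! ### Lie algebra part -/

section LiePart

variable {L : Type*} [LieRing L] [LieAlgebra ℂ L]

namespace LieRootData

variable (D : LieRootData V L)

/-- `h` acts on the root space of `γ` by the scalar `c`. -/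
def Eig (h : L) (γ : V) (c : ℂ) : Prop := ∀ x ∈ D.rs γ, ⁅h, x⁆ = c • x

lemma exists_ne {γ : V} (hγ : γ ∈ D.roots) : ∃ x ∈ D.rs γ, x ≠ 0 := by
  have h := D.rs_dim γ hγ
  have : D.rs γ ≠ ⊥ := by
    intro h0
    rw [h0] at h
    simp at h
  exact Submodule.exists_mem_ne_zero_of_ne_bot this

lemma exists_smul {γ : V} (hγ : γ ∈ D.roots) {x y : L} (hx : x ∈ D.rs γ) (hx0 : x ≠ 0)
    (hy : y ∈ D.rs γ) : ∃ c : ℂ, y = c • x := by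
  obtain ⟨c, hc⟩ := (finrank_eq_one_iff_of_nonzero' (⟨x, hx⟩ : D.rs γ)
    (by simpa using hx0)).1 (D.rs_dim γ hγ) ⟨y, hy⟩
  exact ⟨c, (congrArg Subtype.val hc).symm⟩

lemma eig_of {γ : V} (hγ : γ ∈ D.roots) {h x : L} {c : ℂ} (hx : x ∈ D.rs γ) (hx0 : x ≠ 0)
    (hc : ⁅h, x⁆ = c • x) : D.Eig h γ c := by
  intro y hy
  obtain ⟨d, rfl⟩ := D.exists_smul hγ hx hx0 hy
  rw [lie_smul, hc, smul_comm]

lemma exists_eig {γ : V} (hγ : γ ∈ D.roots) {h : L} (hh : h ∈ D.cartan) :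
    ∃ c, D.Eig h γ c := by
  obtain ⟨x, hx, hx0⟩ := D.exists_ne hγ
  obtain ⟨c, hc⟩ := D.weight_vec γ hγ h hh x hx
  exact ⟨c, D.eig_of hγ hx hx0 hc⟩

lemma Eig.unique {D : LieRootData V L} {γ : V} (hγ : γ ∈ D.roots) {h : L} {c d : ℂ}
    (hc : D.Eig h γ c) (hd : D.Eig h γ d) : c = d := by
  obtain ⟨x, hx, hx0⟩ := D.exists_ne hγ
  have := (hc x hx).symm.trans (hd x hx)
  exact smul_left_injective ℂ hx0 this

lemma Eig.add {D : LieRootData V L} {γ δ ε : V} (hγ : γ ∈ D.roots) (hδ : δ ∈ D.roots)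
    (hs : ε ∈ D.roots) (e : γ + δ = ε) {h : L} {c d : ℂ}
    (hc : D.Eig h γ c) (hd : D.Eig h δ d) : D.Eig h ε (c + d) := by
  subst e
  obtain ⟨x, hx, hx0⟩ := D.exists_ne hγ
  obtain ⟨y, hy, hy0⟩ := D.exists_ne hδ
  refine D.eig_of hs (D.bracket_mem γ hγ δ hδ hs x hx y hy)
    (D.bracket_ne_zero γ hγ δ hδ hs x hx hx0 y hy hy0) ?_
  rw [leibniz_lie, hc x hx, hd y hy, smul_lie, lie_smul, add_smul]

/-- subtracting: from the eigenvalues at `δ` and `ε = γ + δ` get the one at `γ`. -/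
lemma Eig.sub {D : LieRootData V L} {γ δ ε : V} (hγ : γ ∈ D.roots) (hδ : δ ∈ D.roots)
    (hs : ε ∈ D.roots) (e : γ + δ = ε) {h : L} (hh : h ∈ D.cartan) {c d : ℂ}
    (hc : D.Eig h ε c) (hd : D.Eig h δ d) : D.Eig h γ (c - d) := by
  obtain ⟨b, hb⟩ := D.exists_eig hγ hh
  have := Eig.unique hs hc (Eig.add hγ hδ hs e hb hd)
  rw [this]
  simpa using hb

lemma bmem {γ δ ε : V} (hγ : γ ∈ D.roots) (hδ : δ ∈ D.roots)
    (hs : ε ∈ D.roots) (e : γ + δ = ε) {x y : L} (hx : x ∈ D.rs γ) (hy : y ∈ D.rs δ) :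
    ⁅x, y⁆ ∈ D.rs ε := by
  subst e
  exact D.bracket_mem γ hγ δ hδ hs x hx y hy

lemma bne {γ δ ε : V} (hγ : γ ∈ D.roots) (hδ : δ ∈ D.roots)
    (hs : ε ∈ D.roots) (e : γ + δ = ε) {x y : L} (hx : x ∈ D.rs γ) (hy : y ∈ D.rs δ)
    (hx0 : x ≠ 0) (hy0 : y ≠ 0) : ⁅x, y⁆ ≠ 0 := by
  subst e
  exact D.bracket_ne_zero γ hγ δ hδ hs x hx hx0 y hy hy0

variable {D} {p q : V} {n : ℝ}

/-- a bracket vanishes when the sum of the roots has the wrong norm -/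
lemma bzero (C : Cfg D.toRootSystemData p q n) (hI : D.toRootSystemData.IsIrreducible)
    {γ δ : V} (hγ : γ ∈ D.roots) (hδ : δ ∈ D.roots) {x y : L}
    (hx : x ∈ D.rs γ) (hy : y ∈ D.rs δ) (i j : ℝ) (e : γ + δ = i • p + j • q)
    (h0 : 3 < i ^ 2 + i * j + j ^ 2) : ⁅x, y⁆ = 0 := by
  refine D.bracket_eq_zero γ hγ δ hδ (C.not_mem hI i j e ?_ ?_) (C.ne_zero' i j e ?_) x hx y hy
  all_goals
    intro h
    linarith

lemma chain (C : Cfg D.toRootSystemData p q n) (hI : D.toRootSystemData.IsIrreducible)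
    {e u : L} (he : e ∈ D.rs p) (he0 : e ≠ 0) (hu : u ∈ D.rs (-p)) (hu0 : u ≠ 0) :
    ∃ a : ℂ, a ≠ 0 ∧ D.Eig ⁅e, u⁆ p a ∧ D.Eig ⁅e, u⁆ q (a / 2) ∧
      D.Eig ⁅e, u⁆ (p + q) (3 * a / 2) ∧ D.Eig ⁅e, u⁆ (q - p) (-(a / 2)) := by
  have hh := D.bracket_cartan_mem p C.hp e he u hu
  have hnp := D.neg_mem C.hp
  have C1 := C.sub_mem
  have C2 := C.sub_two_mem
  obtain ⟨a, ha⟩ := D.exists_eig C.hp hh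
  obtain ⟨l, hl⟩ := D.exists_eig C.hq hh
  have hl1 : D.Eig ⁅e, u⁆ (q - p) (l - a) := Eig.sub C1 C.hp C.hq (by module) hh hl ha
  have hl2 : D.Eig ⁅e, u⁆ (q - (2 : ℝ) • p) (l - a - a) :=
    Eig.sub C2 C.hp C1 (by module) hh hl1 ha
  have hl3 : D.Eig ⁅e, u⁆ (p + q) (a + l) := Eig.add C.hp C.hq C.hpq rfl ha hl
  obtain ⟨z, hz, hz0⟩ := D.exists_ne C2
  have m1 : ⁅e, z⁆ ∈ D.rs (q - p) := D.bmem C.hp C2 C1 (by module) he hz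
  have n1 : ⁅e, z⁆ ≠ 0 := D.bne C.hp C2 C1 (by module) he hz he0 hz0
  have m2 : ⁅e, ⁅e, z⁆⁆ ∈ D.rs q := D.bmem C.hp C1 C.hq (by module) he m1
  have n2 : ⁅e, ⁅e, z⁆⁆ ≠ 0 := D.bne C.hp C1 C.hq (by module) he m1 he0 n1
  have m3 : ⁅e, ⁅e, ⁅e, z⁆⁆⁆ ∈ D.rs (p + q) := D.bmem C.hp C.hq C.hpq rfl he m2
  have n3 : ⁅e, ⁅e, ⁅e, z⁆⁆⁆ ≠ 0 := D.bne C.hp C.hq C.hpq rfl he m2 he0 n2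
  have z4 : ⁅e, ⁅e, ⁅e, ⁅e, z⁆⁆⁆⁆ = 0 :=
    bzero C hI C.hp C.hpq he m3 2 1 (by module) (by norm_num)
  have u0 : ⁅u, z⁆ = 0 := bzero C hI hnp C2 hu hz (-3) 1 (by module) (by norm_num)
  have comm : ∀ y : L, ⁅u, ⁅e, y⁆⁆ = ⁅e, ⁅u, y⁆⁆ - ⁅⁅e, u⁆, y⁆ := by
    intro y
    rw [lie_lie]
    abel
  have u1 : ⁅u, ⁅e, z⁆⁆ = -(l - a - a) • z := by
    rw [comm, u0, hl2 z hz, lie_zero]; module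
  have u2 : ⁅u, ⁅e, ⁅e, z⁆⁆⁆ = -(2 * l - 3 * a) • ⁅e, z⁆ := by
    rw [comm, u1, hl1 _ m1, lie_smul]; module
  have u3 : ⁅u, ⁅e, ⁅e, ⁅e, z⁆⁆⁆⁆ = -(3 * l - 3 * a) • ⁅e, ⁅e, z⁆⁆ := by
    rw [comm, u2, hl _ m2, lie_smul]; module
  have u4 : ⁅u, ⁅e, ⁅e, ⁅e, ⁅e, z⁆⁆⁆⁆⁆ = -(4 * l - 2 * a) • ⁅e, ⁅e, ⁅e, z⁆⁆⁆ := by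
    rw [comm, u3, hl3 _ m3, lie_smul]; module
  rw [z4, lie_zero] at u4
  have h4 := (smul_eq_zero.1 u4.symm).resolve_right n3
  have hla : l = a / 2 := by linear_combination (-1 / 4) * h4
  refine ⟨a, ?_, ha, hla ▸ hl, ?_, ?_⟩
  · rintro rfl
    have : ⁅u, ⁅e, z⁆⁆ ≠ 0 := D.bne hnp C1 C2 (by module) hu m1 hu0 n1
    apply this
    rw [u1, hla]
    simp
  · convert hl3 using 1
    rw [hla]; ring
  · convert hl1 using 1
    rw [hla]; ring

lemma core (C : Cfg D.toRootSystemData p q n) (hI : D.toRootSystemData.IsIrreducible)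
    {e f : L} (he : e ∈ D.rs p) (he0 : e ≠ 0) (hf : f ∈ D.rs q) (hf0 : f ≠ 0) :
    (LieAlgebra.ad ℂ L (e + f)) ^ 4 ≠ 0 := by
  have hnp := D.neg_mem C.hp
  have hnq := D.neg_mem C.hq
  have hnt := D.neg_mem C.hpq
  have C1 := C.sub_mem
  have C1' := C.symm.sub_mem
  have C2 := D.neg_mem C.sub_two_mem
  have C2' := D.neg_mem C.symm.sub_two_mem
  obtain ⟨v, hv, hv0⟩ := D.exists_ne hnt
  have hu : ⁅f, v⁆ ∈ D.rs (-p) := D.bmem C.hq hnt hnp (by module) hf hv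
  have hu0 : ⁅f, v⁆ ≠ 0 := D.bne C.hq hnt hnp (by module) hf hv hf0 hv0
  have hw : ⁅e, v⁆ ∈ D.rs (-q) := D.bmem C.hp hnt hnq (by module) he hv
  have hw0 : ⁅e, v⁆ ≠ 0 := D.bne C.hp hnt hnq (by module) he hv he0 hv0
  obtain ⟨a, ha0, hap, haq, hat, had⟩ := chain C hI he he0 hu hu0
  obtain ⟨b, hb0, hbq, hbp, hbt, hbd⟩ := chain C.symm hI hf hf0 hw hw0
  have ht : ⁅e, f⁆ ∈ D.rs (p + q) := D.bmem C.hp C.hq C.hpq rfl he hf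
  have ht0 : ⁅e, f⁆ ≠ 0 := D.bne C.hp C.hq C.hpq rfl he hf he0 hf0
  have hT : ⁅⁅e, f⁆, v⁆ = ⁅e, ⁅f, v⁆⁆ - ⁅f, ⁅e, v⁆⁆ := lie_lie e f v
  have hhk : ⁅f, ⁅e, v⁆⁆ ∈ D.cartan := D.bracket_cartan_mem q C.hq f hf _ hw
  -- the relation `b = -a`
  have hba : b = -a := by
    obtain ⟨d, hd, hd0⟩ := D.exists_ne C1'
    have ha' : D.Eig ⁅e, ⁅f, v⁆⁆ (p - q) (a - a / 2) :=
      Eig.sub C1' C.hq C.hp (by module) (D.bracket_cartan_mem p C.hp e he _ hu) hap haq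
    have z1 : ⁅v, d⁆ = 0 := bzero C hI hnt C1' hv hd 0 (-2) (by module) (by norm_num)
    have z2 : ⁅⁅e, f⁆, d⁆ = 0 := bzero C hI C.hpq C1' ht hd 2 0 (by module) (by norm_num)
    have z3 : ⁅⁅⁅e, f⁆, v⁆, d⁆ = 0 := by rw [lie_lie, z1, z2]; simp
    rw [hT, sub_lie, ha' d hd, hbd d hd, ← sub_smul] at z3
    have := (smul_eq_zero.1 z3).resolve_right hd0
    linear_combination 2 * this
  subst hba
  -- brackets that vanish
  have et : ⁅e, ⁅e, f⁆⁆ = 0 := bzero C hI C.hp C.hpq he ht 2 1 (by module) (by norm_num)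
  have ft : ⁅f, ⁅e, f⁆⁆ = 0 := bzero C hI C.hq C.hpq hf ht 1 2 (by module) (by norm_num)
  have mew : ⁅e, ⁅e, v⁆⁆ ∈ D.rs (p - q) := D.bmem C.hp hnq C1' (by module) he hw
  have mfu : ⁅f, ⁅f, v⁆⁆ ∈ D.rs (q - p) := D.bmem C.hq hnp C1 (by module) hf hu
  have meew : ⁅e, ⁅e, ⁅e, v⁆⁆⁆ ∈ D.rs (-(q - (2 : ℝ) • p)) :=
    D.bmem C.hp C1' C2 (by module) he mew
  have mffu : ⁅f, ⁅f, ⁅f, v⁆⁆⁆ ∈ D.rs (-(p - (2 : ℝ) • q)) :=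
    D.bmem C.hq C1 C2' (by module) hf mfu
  have z1 : ⁅e, ⁅e, ⁅e, ⁅e, v⁆⁆⁆⁆ = 0 :=
    bzero C hI C.hp C2 he meew 3 (-1) (by module) (by norm_num)
  have z2 : ⁅f, ⁅e, ⁅e, ⁅e, v⁆⁆⁆⁆ = 0 :=
    bzero C hI C.hq C2 hf meew 2 0 (by module) (by norm_num)
  have z3 : ⁅f, ⁅f, ⁅f, ⁅f, v⁆⁆⁆⁆ = 0 :=
    bzero C hI C.hq C2' hf mffu (-1) 3 (by module) (by norm_num)
  have z4 : ⁅e, ⁅f, ⁅f, ⁅f, v⁆⁆⁆⁆ = 0 :=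
    bzero C hI C.hp C2' he mffu 0 2 (by module) (by norm_num)
  -- the action of the Cartan elements
  have sk : ∀ x y : L, ⁅x, y⁆ = -⁅y, x⁆ := fun x y => (lie_skew x y).symm
  have eh : ⁅e, ⁅e, ⁅f, v⁆⁆⁆ = -(a • e) := by rw [sk, hap e he]
  have fh : ⁅f, ⁅e, ⁅f, v⁆⁆⁆ = -((a / 2) • f) := by rw [sk, haq f hf]
  have ek : ⁅e, ⁅f, ⁅e, v⁆⁆⁆ = (a / 2) • e := by rw [sk, hbp e he]; module
  have fk : ⁅f, ⁅f, ⁅e, v⁆⁆⁆ = a • f := by rw [sk, hbq f hf]; module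
  have th : ⁅⁅e, f⁆, ⁅e, ⁅f, v⁆⁆⁆ = -((3 * a / 2) • ⁅e, f⁆) := by rw [sk, hat _ ht]
  have hbt' := hbt
  rw [add_comm] at hbt'
  have tk : ⁅⁅e, f⁆, ⁅f, ⁅e, v⁆⁆⁆ = (3 * a / 2) • ⁅e, f⁆ := by
    rw [sk, hbt' _ ht]; module
  have fe : ⁅f, e⁆ = -⁅e, f⁆ := sk f e
  -- commuting through
  have efu : ⁅e, ⁅f, ⁅f, v⁆⁆⁆ = -((a / 2) • f) + ⁅⁅e, f⁆, ⁅f, v⁆⁆ := by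
    rw [lie_lie e f, fh]; abel
  have few : ⁅f, ⁅e, ⁅e, v⁆⁆⁆ = (a / 2) • e - ⁅⁅e, f⁆, ⁅e, v⁆⁆ := by
    rw [lie_lie e f, ek]; abel
  have etu : ⁅e, ⁅⁅e, f⁆, ⁅f, v⁆⁆⁆ = -((3 * a / 2) • ⁅e, f⁆) := by
    rw [leibniz_lie, et, zero_lie, zero_add, th]
  have ftw : ⁅f, ⁅⁅e, f⁆, ⁅e, v⁆⁆⁆ = (3 * a / 2) • ⁅e, f⁆ := by
    rw [leibniz_lie, ft, zero_lie, zero_add, tk]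
  have etw : ⁅e, ⁅⁅e, f⁆, ⁅e, v⁆⁆⁆ = 0 := by
    have m : ⁅⁅e, f⁆, ⁅e, v⁆⁆ ∈ D.rs p := D.bmem C.hpq hnq C.hp (by module) ht hw
    exact bzero C hI C.hp C.hp he m 2 0 (by module) (by norm_num)
  have ftu : ⁅f, ⁅⁅e, f⁆, ⁅f, v⁆⁆⁆ = 0 := by
    have m : ⁅⁅e, f⁆, ⁅f, v⁆⁆ ∈ D.rs q := D.bmem C.hpq hnp C.hq (by module) ht hu
    exact bzero C hI C.hq C.hq hf m 0 2 (by module) (by norm_num)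
  intro h0
  have h1 : ((LieAlgebra.ad ℂ L (e + f)) ^ 4) v = (-(3 * a)) • ⁅e, f⁆ := by
    simp only [pow_succ, pow_zero, one_mul, Module.End.mul_apply, LieAlgebra.ad_apply,
      add_lie, lie_add, eh, fh, ek, fk, efu, few, lie_neg, lie_smul, lie_self, lie_sub,
      etu, ftw, etw, ftu, z1, z2, z3, z4, fe]
    module
  rw [h0] at h1
  have := (smul_eq_zero.1 h1.symm).resolve_right ht0
  apply ha0
  linear_combination (-1 / 3) * this

/-- Filtration by the level with respect to `p + q`. -/
def filt (D : LieRootData V L) (p q : V) (n : ℝ) (k : ℝ) : Submodule ℂ L :=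
  (⨆ γ ∈ {γ | γ ∈ D.roots ∧ k * (3 * n / 2) ≤ ⟪γ, p + q⟫}, D.rs γ) ⊔
    (⨆ _ : k ≤ 0, D.cartan.toSubmodule)

lemma rs_le_filt {γ : V} {k : ℝ} (hγ : γ ∈ D.roots) (h : k * (3 * n / 2) ≤ ⟪γ, p + q⟫) :
    D.rs γ ≤ filt D p q n k :=
  le_sup_of_le_left (le_iSup₂_of_le γ ⟨hγ, h⟩ le_rfl)

lemma cartan_le_filt {k : ℝ} (h : k ≤ 0) : D.cartan.toSubmodule ≤ filt D p q n k :=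
  le_sup_of_le_right (le_iSup_of_le h le_rfl)

lemma filt_step {r : V} (hr : r ∈ D.roots) (hn : 0 < n) (hl : ⟪r, p + q⟫ = 3 * n / 2)
    {e : L} (he : e ∈ D.rs r) (k : ℝ) :
    filt D p q n k ≤ (filt D p q n (k + 1)).comap (LieAlgebra.ad ℂ L e) := by
  refine sup_le (iSup₂_le ?_) (iSup_le ?_)
  · rintro γ ⟨hγ, hk⟩ y hy
    rw [Submodule.mem_comap, LieAlgebra.ad_apply]
    by_cases h1 : r + γ ∈ D.roots
    · refine rs_le_filt h1 ?_ (D.bracket_mem r hr γ hγ h1 e he y hy)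
      rw [inner_add_left, hl]; linarith
    by_cases h2 : r + γ = 0
    · have h3 : γ = -r := by rw [eq_neg_iff_add_eq_zero, add_comm]; exact h2
      subst h3
      refine cartan_le_filt ?_ (D.bracket_cartan_mem r hr e he y hy)
      rw [inner_neg_left, hl] at hk
      by_contra hc
      push Not at hc
      nlinarith
    · rw [D.bracket_eq_zero r hr γ hγ h1 h2 e he y hy]
      exact zero_mem _
  · intro hk h hh
    rw [Submodule.mem_comap, LieAlgebra.ad_apply]
    obtain ⟨c, hc⟩ := D.weight_vec r hr h hh e he
    rw [← lie_skew, hc]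
    refine neg_mem (Submodule.smul_mem _ _ (rs_le_filt hr ?_ he))
    rw [hl]
    nlinarith

lemma nilp (C : Cfg D.toRootSystemData p q n) (hI : D.toRootSystemData.IsIrreducible)
    {e f : L} (he : e ∈ D.rs p) (hf : f ∈ D.rs q) :
    (LieAlgebra.ad ℂ L (e + f)) ^ 5 = 0 := by
  have hn := C.hn
  have lp : ⟪p, p + q⟫ = 3 * n / 2 := by rw [inner_add_right, C.pp, C.pq]; ring
  have lq : ⟪q, p + q⟫ = 3 * n / 2 := by rw [inner_add_right, C.qp, C.qq]; ring
  have step : ∀ k y, y ∈ filt D p q n k →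
      LieAlgebra.ad ℂ L (e + f) y ∈ filt D p q n (k + 1) := by
    intro k y hy
    rw [map_add, LinearMap.add_apply]
    exact add_mem (filt_step C.hp hn lp he k hy) (filt_step C.hq hn lq hf k hy)
  have lev : ∀ γ ∈ D.roots, -2 * (3 * n / 2) ≤ ⟪γ, p + q⟫ ∧ ⟪γ, p + q⟫ < 3 * (3 * n / 2) := by
    intro γ hγ
    obtain ⟨x, y, rfl, h⟩ := C.lin hI hγ
    have e : ⟪(x : ℝ) • p + (y : ℝ) • q, p + q⟫ = ((x + y : ℤ) : ℝ) * (3 * n / 2) := by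
      rw [inner_add_left, real_inner_smul_left, real_inner_smul_left, lp, lq]
      push_cast; ring
    have hb : -2 ≤ x + y ∧ x + y ≤ 2 := by
      constructor <;> rcases h with h | h <;> nlinarith [sq_nonneg (x + y), sq_nonneg (x - y)]
    have hb1 : (-2 : ℝ) ≤ ((x + y : ℤ) : ℝ) := by exact_mod_cast hb.1
    have hb2 : ((x + y : ℤ) : ℝ) ≤ 2 := by exact_mod_cast hb.2
    rw [e]
    constructor <;> nlinarith
  have top : filt D p q n (-2) = ⊤ := by
    rw [eq_top_iff, ← D.sup_eq_top]
    exact sup_le (cartan_le_filt (by norm_num))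
      (iSup₂_le fun γ hγ => rs_le_filt hγ (lev γ hγ).1)
  have bot : filt D p q n (-2 + 1 + 1 + 1 + 1 + 1) = ⊥ := by
    rw [eq_bot_iff]
    refine sup_le (iSup₂_le ?_) (iSup_le ?_)
    · rintro γ ⟨hγ, h⟩
      have := (lev γ hγ).2
      norm_num at h
      exfalso
      linarith
    · intro h
      norm_num at h
  ext y
  have h0 : y ∈ filt D p q n (-2) := by rw [top]; trivial
  have h5 := step _ _ (step _ _ (step _ _ (step _ _ (step _ _ h0))))
  rw [bot, Submodule.mem_bot] at h5
  simpa only [pow_succ, pow_zero, one_mul, Module.End.mul_apply, LinearMap.zero_apply] using h5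

lemma final (C : Cfg D.toRootSystemData p q n) (hI : D.toRootSystemData.IsIrreducible)
    {e f : L} (he : e ∈ D.rs p) (he0 : e ≠ 0) (hf : f ∈ D.rs q) (hf0 : f ≠ 0) :
    (LieAlgebra.ad ℂ L (e + f)) ^ 4 ≠ 0 ∧ 4 ≤ heightOf (e + f) := by
  have h := core C hI he he0 hf hf0
  refine ⟨h, le_csSup ⟨5, ?_⟩ h⟩
  intro m hm
  by_contra hc
  push Not at hc
  exact hm (pow_eq_zero_of_le hc.le (nilp C hI he hf))

end LieRootData

end LiePart

/-- Suppose `𝔤` is the complex simple Lie algebra of type `G₂`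
with simple roots `α₁` (short) and `α₂` (long). Then for any nonzero root
vectors, `ad(e_{α₁} + e_{2α₁+α₂})^4 ≠ 0` and `ad(e_{α₁+α₂} + e_{2α₁+α₂})^4 ≠ 0`;
in particular these two nilpotent elements have height at least `4`. -/
theorem g2_explicit_nonspherical
    {V : Type*} [NormedAddCommGroup V] [InnerProductSpace ℝ V]
    {L : Type*} [LieRing L] [LieAlgebra ℂ L]
    (D : LieRootData V L)
    (hG2 : D.toRootSystemData.IsG2)
    (α₁ α₂ : V)
    (h1 : α₁ ∈ D.toRootSystemData.simpleRoots)
    (h2 : α₂ ∈ D.toRootSystemData.simpleRoots)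
    (hlt : ‖α₁‖ < ‖α₂‖)
    (e1 e2 e3 : L)
    (he1 : e1 ∈ D.rs α₁) (he10 : e1 ≠ 0)
    (he2 : e2 ∈ D.rs (2 • α₁ + α₂)) (he20 : e2 ≠ 0)
    (he3 : e3 ∈ D.rs (α₁ + α₂)) (he30 : e3 ≠ 0) :
    ((LieAlgebra.ad ℂ L (e1 + e2)) ^ 4 ≠ 0 ∧ 4 ≤ heightOf (e1 + e2)) ∧
      ((LieAlgebra.ad ℂ L (e3 + e2)) ^ 4 ≠ 0 ∧ 4 ≤ heightOf (e3 + e2)) := by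
  obtain ⟨q, n, C, hα⟩ := simple_cfg D.toRootSystemData hG2 h1 h2 hlt
  have hI := hG2.1
  have e2q : 2 • α₁ + α₂ = q := by rw [hα, two_smul, two_smul]; abel
  have e3q : α₁ + α₂ = q - α₁ := by rw [hα, two_smul]; abel
  rw [e2q] at he2
  rw [e3q] at he3
  exact ⟨LieRootData.final C hI he1 he10 he2 he20,
    LieRootData.final C.rot.symm hI he3 he30 he2 he20⟩
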